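/- arXiv:2302.01088 — 9 statements merged into one kernel-verified Lean document; each statement's English description precedes it below -/
import Mathlib

section
/- Let φ, ψ > 0 with φψ⁻¹ > 1, and let H be a Borel probability measure on ℝ whose support is contained in an interval [C₀, C₁] with 0 < C₀ ≤ C₁. Then there exists a unique real number c₀ < 0 satisfying the self-consistent equation 1 = ∫ x/(−c₀ + x·ψφ⁻¹) dH(x). -/
open MeasureTheory

/-- For a positive ratio `r` and `t ≥ 0`, the integrand `x / (t + x r)` is bounded by `r⁻¹`. -/
theorem norm_div_add_mul_le_inv {r t x : ℝ} (hr : 0 < r) (ht : 0 ≤ t) (hx : 0 < x) :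
    ‖x / (t + x * r)‖ ≤ r⁻¹ := by
  have hxr := mul_pos hx hr
  rw [Real.norm_of_nonneg (by positivity), div_le_iff₀ (by positivity), inv_mul_eq_div,
    le_div_iff₀ hr]
  linarith

theorem measurable_div_add_mul (r t : ℝ) : Measurable fun x : ℝ => x / (t + x * r) := by
  fun_prop

theorem integrable_div_add_mul {H : Measure ℝ} [IsFiniteMeasure H] (hpos : ∀ᵐ x ∂H, 0 < x)
    {r t : ℝ} (hr : 0 < r) (ht : 0 ≤ t) : Integrable (fun x => x / (t + x * r)) H :=
  .of_bound (measurable_div_add_mul r t).aestronglyMeasurable r⁻¹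
    (hpos.mono fun _ hx => norm_div_add_mul_le_inv hr ht hx)

theorem continuousOn_integral_div_add_mul {H : Measure ℝ} [IsFiniteMeasure H]
    (hpos : ∀ᵐ x ∂H, 0 < x) {r : ℝ} (hr : 0 < r) :
    ContinuousOn (fun t => ∫ x, x / (t + x * r) ∂H) (Set.Ici 0) := by
  refine continuousOn_of_dominated (bound := fun _ => r⁻¹)
    (fun t _ => (measurable_div_add_mul r t).aestronglyMeasurable)
    (fun t ht => hpos.mono fun x hx => norm_div_add_mul_le_inv hr ht hx)
    (integrable_const _) (hpos.mono fun x hx => ?_)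
  refine continuousOn_const.div (by fun_prop) fun t ht => ?_
  exact (add_pos_of_nonneg_of_pos ht (mul_pos hx hr)).ne'

theorem strictAntiOn_integral_div_add_mul {H : Measure ℝ} [IsProbabilityMeasure H]
    (hpos : ∀ᵐ x ∂H, 0 < x) {r : ℝ} (hr : 0 < r) :
    StrictAntiOn (fun t => ∫ x, x / (t + x * r) ∂H) (Set.Ici 0) := by
  intro a ha b hb hab
  have hlt : ∀ᵐ x ∂H, x / (b + x * r) < x / (a + x * r) := hpos.mono fun x hx =>
    div_lt_div_of_pos_left hx (add_pos_of_nonneg_of_pos ha (mul_pos hx hr)) (by linarith)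
  have hle : (fun x => x / (b + x * r)) ≤ᵐ[H] fun x => x / (a + x * r) := hlt.mono fun _ h => h.le
  have hia := integrable_div_add_mul hpos hr ha
  have hib := integrable_div_add_mul hpos hr hb
  refine lt_of_le_of_ne (integral_mono_ae hib hia hle) fun h => ?_
  obtain ⟨x, hx, hx'⟩ := (((integral_eq_iff_of_ae_le hib hia hle).1 h).and hlt).exists
  exact hx'.ne hx

/-- Existence and uniqueness of the negative solution of the self-consistent equation
`1 = ∫ x / (-c₀ + x ψ φ⁻¹) dH(x)` in the overparameterized regime `φψ⁻¹ > 1`. -/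
theorem unique_negative_solution_over
    (φ ψ C₀ C₁ : ℝ) (hφ : 0 < φ) (hψ : 0 < ψ) (hratio : 1 < φ * ψ⁻¹)
    (hC₀ : 0 < C₀) (hC : C₀ ≤ C₁)
    (H : Measure ℝ) [IsProbabilityMeasure H]
    (hsupp : H (Set.Icc C₀ C₁)ᶜ = 0) :
    ∃! c₀ : ℝ, c₀ < 0 ∧ 1 = ∫ x, x / (-c₀ + x * (ψ * φ⁻¹)) ∂H := by
  have hmem : ∀ᵐ x ∂H, x ∈ Set.Icc C₀ C₁ := hsupp
  have hpos : ∀ᵐ x ∂H, 0 < x := hmem.mono fun x hx => hC₀.trans_le hx.1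
  have hr : 0 < ψ * φ⁻¹ := by positivity
  have hinv : (ψ * φ⁻¹)⁻¹ = φ * ψ⁻¹ := by rw [mul_inv, inv_inv, mul_comm]
  generalize ψ * φ⁻¹ = r at hr hinv ⊢
  have hC₁ : 0 < C₁ := hC₀.trans_le hC
  have hzero : 1 < ∫ x, x / (0 + x * r) ∂H := by
    have hcongr : ∫ x, x / (0 + x * r) ∂H = ∫ _, r⁻¹ ∂H :=
      integral_congr_ae (hpos.mono fun x hx => by field_simp; simp)
    rw [hcongr, integral_const, probReal_univ, one_smul, hinv]
    exact hratio
  have hend : ∫ x, x / (C₁ + x * r) ∂H ≤ 1 := by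
    have hle := integral_mono_ae (integrable_div_add_mul hpos hr hC₁.le)
      (integrable_const (1 : ℝ)) (hmem.mono fun x hx => by
        have hxr := mul_pos (hC₀.trans_le hx.1) hr
        exact div_le_one_of_le₀ (by linarith [hx.2]) (by linarith))
    simpa using hle
  obtain ⟨t, ht, hFt⟩ := intermediate_value_Icc' hC₁.le
    ((continuousOn_integral_div_add_mul hpos hr).mono Set.Icc_subset_Ici_self) ⟨hend, hzero.le⟩
  have ht0 : 0 < t := lt_of_le_of_ne ht.1 fun h => by
    subst h
    exact hzero.ne' hFt
  refine ⟨-t, ⟨neg_neg_of_pos ht0, by rw [neg_neg]; exact hFt.symm⟩, fun c hc => ?_⟩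
  rw [← (strictAntiOn_integral_div_add_mul hpos hr).injOn (neg_pos.2 hc.1).le ht0.le
    (hc.2.symm.trans hFt.symm), neg_neg]
end

section
/- Let φ, ψ > 0 with φψ⁻¹ < 1, and let B be a Borel probability measure on ℝ whose support is contained in an interval [C̃₀, C̃₁] with 0 < C̃₀ ≤ C̃₁. Then there exists a unique real number c̃₀ < 0 satisfying the self-consistent equation 1 = ψ ∫ x/(−c̃₀ + x·φ) dB(x). -/
open MeasureTheory

section ResolventIntegral

variable {φ C₀ C₁ : ℝ} {B : Measure ℝ}

lemma ae_mem_Icc_of_measure_compl (hsupp : B (Set.Icc C₀ C₁)ᶜ = 0) :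
    ∀ᵐ x ∂B, x ∈ Set.Icc C₀ C₁ :=
  hsupp

lemma norm_div_add_mul_le {t x : ℝ} (hφ : 0 < φ) (ht : 0 ≤ t) (hx : 0 < x) :
    ‖x / (t + x * φ)‖ ≤ φ⁻¹ := by
  have h : 0 < t + x * φ := by positivity
  rw [Real.norm_of_nonneg (by positivity), div_le_iff₀ h]
  have : φ⁻¹ * (t + x * φ) = φ⁻¹ * t + x := by field_simp
  rw [this]
  have : 0 ≤ φ⁻¹ * t := by positivity
  linarith

lemma aestronglyMeasurable_div_add_mul (t : ℝ) :
    AEStronglyMeasurable (fun x : ℝ => x / (t + x * φ)) B :=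
  Measurable.aestronglyMeasurable (by fun_prop)

lemma integrable_div_add_mul_s1 [IsFiniteMeasure B] {t : ℝ} (hφ : 0 < φ) (hC₀ : 0 < C₀)
    (hsupp : B (Set.Icc C₀ C₁)ᶜ = 0) (ht : 0 ≤ t) :
    Integrable (fun x : ℝ => x / (t + x * φ)) B := by
  refine Integrable.of_bound (aestronglyMeasurable_div_add_mul t) φ⁻¹ ?_
  filter_upwards [ae_mem_Icc_of_measure_compl hsupp] with x hx
  exact norm_div_add_mul_le hφ ht (hC₀.trans_le hx.1)

lemma continuousOn_integral_div_add_mul_s1 [IsFiniteMeasure B] (hφ : 0 < φ) (hC₀ : 0 < C₀)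
    (hsupp : B (Set.Icc C₀ C₁)ᶜ = 0) :
    ContinuousOn (fun t : ℝ => ∫ x, x / (t + x * φ) ∂B) (Set.Ici 0) := by
  refine continuousOn_of_dominated (bound := fun _ => φ⁻¹)
    (fun t _ => aestronglyMeasurable_div_add_mul t) (fun t ht => ?_) (integrable_const _) ?_
  · filter_upwards [ae_mem_Icc_of_measure_compl hsupp] with x hx
    exact norm_div_add_mul_le hφ ht (hC₀.trans_le hx.1)
  · filter_upwards [ae_mem_Icc_of_measure_compl hsupp] with x hx
    have hx₀ : 0 < x := hC₀.trans_le hx.1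
    refine ContinuousOn.div (by fun_prop) (by fun_prop) fun t ht => ?_
    have ht' : 0 ≤ t := ht
    positivity

lemma strictAntiOn_integral_div_add_mul_s1 [IsProbabilityMeasure B] (hφ : 0 < φ) (hC₀ : 0 < C₀)
    (hC : C₀ ≤ C₁) (hsupp : B (Set.Icc C₀ C₁)ᶜ = 0) :
    StrictAntiOn (fun t : ℝ => ∫ x, x / (t + x * φ) ∂B) (Set.Ici 0) := by
  intro s hs t ht hst
  have hs' : 0 ≤ s := hs
  have ht' : 0 ≤ t := ht
  have hC₁ : 0 < C₁ := hC₀.trans_le hC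
  have hts : 0 < t - s := sub_pos.2 hst
  have hgap : 0 < C₀ * (t - s) / ((s + C₁ * φ) * (t + C₁ * φ)) := by positivity
  have hle : ∫ _, C₀ * (t - s) / ((s + C₁ * φ) * (t + C₁ * φ)) ∂B
      ≤ ∫ x, (x / (s + x * φ) - x / (t + x * φ)) ∂B := by
    refine integral_mono_ae (integrable_const _)
      ((integrable_div_add_mul_s1 hφ hC₀ hsupp hs').sub
        (integrable_div_add_mul_s1 hφ hC₀ hsupp ht')) ?_
    filter_upwards [ae_mem_Icc_of_measure_compl hsupp] with x hx
    have hx₀ : 0 < x := hC₀.trans_le hx.1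
    have hsx : 0 < s + x * φ := by positivity
    have htx : 0 < t + x * φ := by positivity
    have heq : x / (s + x * φ) - x / (t + x * φ)
        = x * (t - s) / ((s + x * φ) * (t + x * φ)) := by
      field_simp
      ring
    rw [heq]
    have h₀ := hx.1
    have h₁ := hx.2
    gcongr
  rw [integral_sub (integrable_div_add_mul_s1 hφ hC₀ hsupp hs')
    (integrable_div_add_mul_s1 hφ hC₀ hsupp ht')] at hle
  simp only [integral_const, probReal_univ, one_smul] at hle
  exact sub_pos.1 (hgap.trans_le hle)

lemma integral_div_mul_self [IsProbabilityMeasure B] (hC₀ : 0 < C₀)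
    (hsupp : B (Set.Icc C₀ C₁)ᶜ = 0) :
    ∫ x, x / (0 + x * φ) ∂B = φ⁻¹ := by
  have h : (fun x : ℝ => x / (0 + x * φ)) =ᵐ[B] fun _ => φ⁻¹ := by
    filter_upwards [ae_mem_Icc_of_measure_compl hsupp] with x hx
    have hx₀ : x ≠ 0 := (hC₀.trans_le hx.1).ne'
    rw [zero_add, div_mul_cancel_left₀ hx₀]
  rw [integral_congr_ae h]
  simp

lemma integral_div_add_mul_le [IsProbabilityMeasure B] {t : ℝ} (hφ : 0 < φ) (hC₀ : 0 < C₀)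
    (hsupp : B (Set.Icc C₀ C₁)ᶜ = 0) (ht : 0 < t) :
    ∫ x, x / (t + x * φ) ∂B ≤ C₁ / t := by
  have h : ∫ x, x / (t + x * φ) ∂B ≤ ∫ _, C₁ / t ∂B := by
    refine integral_mono_ae (integrable_div_add_mul_s1 hφ hC₀ hsupp ht.le) (integrable_const _) ?_
    filter_upwards [ae_mem_Icc_of_measure_compl hsupp] with x hx
    have hx₀ : 0 < x := hC₀.trans_le hx.1
    have hC₁ : 0 ≤ C₁ := hx₀.le.trans hx.2
    exact div_le_div₀ hC₁ hx.2 ht (le_add_of_nonneg_right (by positivity))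
  simpa using h

end ResolventIntegral

/-- Existence and uniqueness of the negative solution of the self-consistent equation
`1 = ψ ∫ x / (-c̃₀ + x φ) dB(x)` in the underparameterized regime `φψ⁻¹ < 1`. -/
theorem unique_negative_solution_under
    (φ ψ C₀ C₁ : ℝ) (hφ : 0 < φ) (hψ : 0 < ψ) (hratio : φ * ψ⁻¹ < 1)
    (hC₀ : 0 < C₀) (hC : C₀ ≤ C₁)
    (B : Measure ℝ) [IsProbabilityMeasure B]
    (hsupp : B (Set.Icc C₀ C₁)ᶜ = 0) :
    ∃! c₀ : ℝ, c₀ < 0 ∧ 1 = ψ * ∫ x, x / (-c₀ + x * φ) ∂B := by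
  have hC₁ : 0 < C₁ := hC₀.trans_le hC
  have hφψ : ψ⁻¹ < φ⁻¹ := by
    rwa [← one_div φ, lt_div_iff₀ hφ, mul_comm]
  have hT : 0 < C₁ * ψ := by positivity
  have hupper : ∫ x, x / (C₁ * ψ + x * φ) ∂B ≤ ψ⁻¹ := by
    have h := integral_div_add_mul_le hφ hC₀ hsupp hT
    rwa [div_mul_cancel_left₀ hC₁.ne'] at h
  have hzero := integral_div_mul_self (φ := φ) hC₀ hsupp
  have hcont := (continuousOn_integral_div_add_mul_s1 hφ hC₀ hsupp).mono
    (Set.Icc_subset_Ici_self : Set.Icc 0 (C₁ * ψ) ⊆ Set.Ici 0)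
  obtain ⟨t, ht, hFt⟩ := intermediate_value_Icc' hT.le hcont
    ⟨hupper, hφψ.le.trans_eq hzero.symm⟩
  simp only at hFt
  have ht₀ : 0 < t := by
    refine lt_of_le_of_ne ht.1 ?_
    rintro rfl
    exact hφψ.ne (hFt.symm.trans hzero)
  refine ⟨-t, ⟨neg_lt_zero.2 ht₀, ?_⟩, ?_⟩
  · rw [neg_neg, hFt, mul_inv_cancel₀ hψ.ne']
  · rintro c ⟨hc, hceq⟩
    have hFc : ∫ x, x / (-c + x * φ) ∂B = ψ⁻¹ :=
      eq_inv_of_mul_eq_one_right hceq.symm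
    have h : -c = t := (strictAntiOn_integral_div_add_mul_s1 hφ hC₀ hC hsupp).injOn
      (neg_pos.2 hc).le ht₀.le (hFc.trans hFt.symm)
    rw [← h, neg_neg]
end

section
/- Let 0 < φ < ψ and σ > 0. Let B be a Borel probability measure on ℝ whose support is contained in an interval [C̃₀, C̃₁] with 0 < C̃₀ ≤ C̃₁, let c̃₀(B) < 0 be the unique negative solution of 1 = ψ ∫ x/(−c̃₀ + x·φ) dB(x), and set J(B) = ψ ∫ x²φ/(c̃₀(B) − xφ)² dB(x). Then J(B) ≥ φ/ψ, with equality when B is the Dirac measure δ_a at any point a > 0; consequently, since J(B) < 1, the limiting variance σ²·J(B)/(1 − J(B)) is minimized over all such B by the Dirac measures, with minimal value σ²·(φψ⁻¹)/(1 − φψ⁻¹). (Orthogonal sketching, whose limiting spectral distribution of SSᵀ is a Dirac measure, minimizes the limiting out-of-sample prediction risk in the underparameterized regime.) -/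
open MeasureTheory

/-- The integrand of `J` is `φ` times the square of the integrand in the fixed-point equation. -/
lemma sq_mul_div_sq_eq (x c φ : ℝ) :
    x ^ 2 * φ / (c - x * φ) ^ 2 = φ * (x / (-c + x * φ)) ^ 2 := by
  rw [show c - x * φ = -(-c + x * φ) by ring, neg_sq, div_pow]
  ring

lemma div_neg_add_mul_nonneg {x c φ : ℝ} (hφ : 0 < φ) (hx : 0 < x) (hc : c < 0) :
    0 ≤ x / (-c + x * φ) :=
  div_nonneg hx.le (by nlinarith [mul_pos hx hφ])

lemma mul_div_neg_add_mul_le_one {x c φ : ℝ} (hφ : 0 < φ) (hx : 0 < x) (hc : c < 0) :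
    φ * (x / (-c + x * φ)) ≤ 1 := by
  have hd : 0 < -c + x * φ := by nlinarith [mul_pos hx hφ]
  rw [← mul_div_assoc, div_le_one hd]
  linarith [mul_comm x φ]

lemma ae_mem_of_measure_compl_eq_zero {B : Measure ℝ} {s : Set ℝ} (h : B sᶜ = 0) :
    ∀ᵐ x ∂B, x ∈ s :=
  mem_ae_iff.2 h

lemma memLp_two_div_neg_add_mul {φ C₀ C₁ c : ℝ} (hφ : 0 < φ) (hC₀ : 0 < C₀) (hc : c < 0)
    {B : Measure ℝ} [IsProbabilityMeasure B] (hsupp : B (Set.Icc C₀ C₁)ᶜ = 0) :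
    MemLp (fun x => x / (-c + x * φ)) 2 B := by
  refine MemLp.of_bound (C := 1 / φ) (Measurable.aestronglyMeasurable (by fun_prop)) ?_
  filter_upwards [ae_mem_of_measure_compl_eq_zero hsupp] with x hx
  have hx0 : 0 < x := hC₀.trans_le hx.1
  rw [Real.norm_of_nonneg (div_neg_add_mul_nonneg hφ hx0 hc), le_div_iff₀ hφ, mul_comm]
  exact mul_div_neg_add_mul_le_one hφ hx0 hc

lemma div_le_sketchingIntegral {φ ψ C₀ C₁ c : ℝ} (hφ : 0 < φ) (hψ : 0 < ψ) (hC₀ : 0 < C₀)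
    {B : Measure ℝ} [IsProbabilityMeasure B] (hsupp : B (Set.Icc C₀ C₁)ᶜ = 0) (hc : c < 0)
    (h : 1 = ψ * ∫ x, x / (-c + x * φ) ∂B) :
    φ / ψ ≤ ψ * ∫ x, x ^ 2 * φ / (c - x * φ) ^ 2 ∂B := by
  have hL := memLp_two_div_neg_add_mul hφ hC₀ hc hsupp
  have hvar := ProbabilityTheory.variance_nonneg (fun x => x / (-c + x * φ)) B
  rw [ProbabilityTheory.variance_eq_sub hL] at hvar
  have hmean : ∫ x, x / (-c + x * φ) ∂B = 1 / ψ := by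
    rw [eq_div_iff hψ.ne', mul_comm]
    exact h.symm
  simp only [Pi.pow_apply, hmean] at hvar
  simp only [sq_mul_div_sq_eq, integral_const_mul]
  calc φ / ψ = ψ * (φ * (1 / ψ) ^ 2) := by field_simp
    _ ≤ _ := by gcongr; linarith

lemma sketchingIntegral_lt_one {φ ψ C₀ C₁ c : ℝ} (hφ : 0 < φ) (hψ : 0 < ψ) (hC₀ : 0 < C₀)
    (hC : C₀ ≤ C₁) {B : Measure ℝ} [IsProbabilityMeasure B]
    (hsupp : B (Set.Icc C₀ C₁)ᶜ = 0) (hc : c < 0)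
    (h : 1 = ψ * ∫ x, x / (-c + x * φ) ∂B) :
    (ψ * ∫ x, x ^ 2 * φ / (c - x * φ) ^ 2 ∂B) < 1 := by
  have hL := memLp_two_div_neg_add_mul hφ hC₀ hc hsupp
  have hC₁ : 0 < C₁ := hC₀.trans_le hC
  have hd₁ : 0 < -c + C₁ * φ := by nlinarith [mul_pos hC₁ hφ]
  set k := φ * (C₁ / (-c + C₁ * φ)) with hk
  have hk1 : k < 1 := by
    rw [hk, ← mul_div_assoc, div_lt_one hd₁]
    linarith [mul_comm C₁ φ]
  have hle : ∫ x, x ^ 2 * φ / (c - x * φ) ^ 2 ∂B ≤ ∫ x, k * (x / (-c + x * φ)) ∂B := by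
    simp only [sq_mul_div_sq_eq]
    refine integral_mono_ae (hL.integrable_sq.const_mul φ)
      ((hL.integrable one_le_two).const_mul k) ?_
    filter_upwards [ae_mem_of_measure_compl_eq_zero hsupp] with x hx
    have hx0 : 0 < x := hC₀.trans_le hx.1
    have hd : 0 < -c + x * φ := by nlinarith [mul_pos hx0 hφ]
    rw [sq, ← mul_assoc]
    refine mul_le_mul_of_nonneg_right ?_ (div_neg_add_mul_nonneg hφ hx0 hc)
    refine mul_le_mul_of_nonneg_left ?_ hφ.le
    rw [div_le_div_iff₀ hd hd₁]
    nlinarith [hx.2]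
  calc _ ≤ ψ * ∫ x, k * (x / (-c + x * φ)) ∂B := by gcongr
    _ = k * (ψ * ∫ x, x / (-c + x * φ) ∂B) := by rw [integral_const_mul]; ring
    _ = k := by rw [← h, mul_one]
    _ < 1 := hk1

/-- In the underparameterized regime, the quantity `J(B) = ψ ∫ x²φ/(c̃₀(B) - xφ)² dB(x)` is
at least `φ/ψ`, with equality for Dirac measures, `J(B) < 1`, and hence the limiting variance
`σ² J/(1-J)` is minimized (over admissible `B`) by Dirac measures, with minimal
value `σ² (φψ⁻¹)/(1 - φψ⁻¹)`. -/
theorem orthogonal_sketching_optimal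
    (φ ψ σ C₀ C₁ : ℝ) (hφ : 0 < φ) (hφψ : φ < ψ) (hσ : 0 < σ)
    (hC₀ : 0 < C₀) (hC : C₀ ≤ C₁)
    (B : Measure ℝ) [IsProbabilityMeasure B]
    (hsupp : B (Set.Icc C₀ C₁)ᶜ = 0)
    (c₀ : ℝ) (hc₀neg : c₀ < 0)
    (hc₀ : 1 = ψ * ∫ x, x / (-c₀ + x * φ) ∂B) :
    φ / ψ ≤ ψ * ∫ x, x ^ 2 * φ / (c₀ - x * φ) ^ 2 ∂B ∧
    (ψ * ∫ x, x ^ 2 * φ / (c₀ - x * φ) ^ 2 ∂B) < 1 ∧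
    σ ^ 2 * (φ * ψ⁻¹) / (1 - φ * ψ⁻¹) ≤
      σ ^ 2 * (ψ * ∫ x, x ^ 2 * φ / (c₀ - x * φ) ^ 2 ∂B) /
        (1 - ψ * ∫ x, x ^ 2 * φ / (c₀ - x * φ) ^ 2 ∂B) ∧
    (∀ a : ℝ, 0 < a → ∀ c' : ℝ, c' < 0 →
      1 = ψ * ∫ x, x / (-c' + x * φ) ∂(Measure.dirac a) →
      ψ * ∫ x, x ^ 2 * φ / (c' - x * φ) ^ 2 ∂(Measure.dirac a) = φ / ψ) := by
  have hψ : 0 < ψ := hφ.trans hφψ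
  refine ⟨?_, ?_, ?_, ?_⟩
  · exact div_le_sketchingIntegral hφ hψ hC₀ hsupp hc₀neg hc₀
  · exact sketchingIntegral_lt_one hφ hψ hC₀ hC hsupp hc₀neg hc₀
  · have h1 := div_le_sketchingIntegral hφ hψ hC₀ hsupp hc₀neg hc₀
    have h2 := sketchingIntegral_lt_one hφ hψ hC₀ hC hsupp hc₀neg hc₀
    rw [div_eq_mul_inv] at h1
    gcongr
  · intro a _ c _ h
    rw [integral_dirac] at h ⊢
    have hf : a / (-c + a * φ) = 1 / ψ := by
      rw [eq_div_iff hψ.ne', mul_comm]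
      exact h.symm
    rw [sq_mul_div_sq_eq, hf]
    field_simp
end

section
/- Let α > σ > 0 and let φ satisfy 1 − σ/(2α) < φ ≤ α/(α − σ). Set ψ* = (α − σ)φ/α. Then ψ* ∈ (0, 1], φ/ψ* = α/(α − σ) > 1, R(φ/ψ*) = σ(2α − σ), and for every ψ ∈ (0, 1] with φ/ψ ≠ 1 one has R(φ/ψ) ≥ σ(2α − σ). (The optimal sketching size is m* = ((α − σ)/α)·φ·n, i.e., the optimal downsampling ratio is ψ*.) -/
/-- The limiting out-of-sample prediction risk of the orthogonally sketched ridgeless least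
squares estimator at effective aspect ratio `γ`. -/
noncomputable def Risk (α σ γ : ℝ) : ℝ :=
  if γ < 1 then σ ^ 2 * γ / (1 - γ) else α ^ 2 * (1 - 1 / γ) + σ ^ 2 / (γ - 1)

theorem risk_at_minimizer {α σ : ℝ} (hσ : 0 < σ) (hα : σ < α) :
    Risk α σ (α / (α - σ)) = σ * (2 * α - σ) := by
  have hα0 : 0 < α := hσ.trans hα
  have hd : 0 < α - σ := sub_pos.mpr hα
  have hγ : ¬ α / (α - σ) < 1 := by
    rw [not_lt, one_le_div hd]
    linarith
  have hsub : α / (α - σ) - 1 = σ / (α - σ) := by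
    field_simp
    ring
  rw [Risk, if_neg hγ, hsub]
  field_simp
  ring

/-- In the underparametrized regime the risk is at least `σ(2α-σ)` once `γ ≥ 1 - σ/(2α)`. -/
theorem le_risk_of_lt_one {α σ γ : ℝ} (hσ : 0 < σ) (hγ : γ < 1)
    (h : 2 * α - σ ≤ 2 * α * γ) : σ * (2 * α - σ) ≤ Risk α σ γ := by
  rw [Risk, if_pos hγ, le_div_iff₀ (sub_pos.mpr hγ)]
  nlinarith [mul_le_mul_of_nonneg_left h hσ.le]

/-- In the overparametrized regime the risk is at least `σ(2α-σ)`. -/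
theorem le_risk_of_one_lt (α σ : ℝ) {γ : ℝ} (hγ : 1 < γ) :
    σ * (2 * α - σ) ≤ Risk α σ γ := by
  have hγ0 : 0 < γ := one_pos.trans hγ
  have hd : 0 < γ - 1 := sub_pos.mpr hγ
  have key : α ^ 2 * (1 - 1 / γ) + σ ^ 2 / (γ - 1) - σ * (2 * α - σ) =
      (α * (γ - 1) - σ * γ) ^ 2 / (γ * (γ - 1)) := by
    field_simp
    ring
  have hnonneg : 0 ≤ (α * (γ - 1) - σ * γ) ^ 2 / (γ * (γ - 1)) := by positivity
  rw [Risk, if_neg hγ.not_gt]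
  linarith

/-- When `SNR = α/σ > 1` and `1 - σ/(2α) < φ ≤ α/(α-σ)`, the optimal downsampling ratio is
`ψ* = (α-σ)φ/α`: it lies in `(0,1]`, yields effective aspect ratio `α/(α-σ) > 1`, achieves
risk `σ(2α-σ)`, and this is the minimal risk over all downsampling ratios `ψ ∈ (0,1]`. -/
theorem optimal_sketching_size_high_snr
    (α σ φ : ℝ) (hσ : 0 < σ) (hα : σ < α)
    (hφ1 : 1 - σ / (2 * α) < φ) (hφ2 : φ ≤ α / (α - σ)) :
    (0 < (α - σ) * φ / α ∧ (α - σ) * φ / α ≤ 1) ∧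
    φ / ((α - σ) * φ / α) = α / (α - σ) ∧
    1 < α / (α - σ) ∧
    Risk α σ (φ / ((α - σ) * φ / α)) = σ * (2 * α - σ) ∧
    (∀ ψ : ℝ, 0 < ψ → ψ ≤ 1 → φ / ψ ≠ 1 → σ * (2 * α - σ) ≤ Risk α σ (φ / ψ)) := by
  have hα0 : 0 < α := hσ.trans hα
  have hd : 0 < α - σ := sub_pos.mpr hα
  have hφ : 2 * α - σ < 2 * α * φ := by
    have h : 2 * α * (1 - σ / (2 * α)) = 2 * α - σ := by field_simp
    rw [← h]
    gcongr
  have hφ0 : 0 < φ := by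
    by_contra! h
    nlinarith
  have hγ : φ / ((α - σ) * φ / α) = α / (α - σ) := by field_simp
  have hγ1 : 1 < α / (α - σ) := by
    rw [one_lt_div hd]
    linarith
  refine ⟨⟨by positivity, ?_⟩, hγ, hγ1, ?_, fun ψ hψ0 hψ1 hne => ?_⟩
  · rw [le_div_iff₀ hd] at hφ2
    rw [div_le_one hα0]
    linarith
  · rw [hγ]
    exact risk_at_minimizer hσ hα
  · rcases hne.lt_or_gt with h | h
    · refine le_risk_of_lt_one hσ h ?_
      have hle : φ ≤ φ / ψ := le_div_self hφ0.le hψ0 hψ1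
      nlinarith
    · exact le_risk_of_one_lt α σ h
end

section
/- Let 0 < α ≤ σ and let φ > α²/(α² + σ²). Then for every ψ ∈ (0, 1] with φ/ψ ≠ 1 one has R(φ/ψ) > α², and R(φ/ψ) → α² as ψ → 0⁺. (Hence the null estimator β̃ = 0, whose risk is α² and which corresponds to sketching size m* = 0, is optimal.) -/
open Filter

theorem lt_risk_of_lt_one {α σ γ : ℝ} (hα : 0 < α) (hγ : α ^ 2 / (α ^ 2 + σ ^ 2) < γ)
    (h1 : γ < 1) : α ^ 2 < Risk α σ γ := by
  have hpos : 0 < α ^ 2 + σ ^ 2 := by positivity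
  rw [div_lt_iff₀ hpos] at hγ
  rw [Risk, if_pos h1, lt_div_iff₀ (sub_pos.2 h1)]
  linarith

theorem lt_risk_of_one_lt {α σ γ : ℝ} (hα : 0 < α) (hσ : α ≤ σ) (h1 : 1 < γ) :
    α ^ 2 < Risk α σ γ := by
  have hsq : α ^ 2 ≤ σ ^ 2 := pow_le_pow_left₀ hα.le hσ 2
  have h : α ^ 2 / γ < σ ^ 2 / (γ - 1) := by
    rw [div_lt_div_iff₀ (by linarith) (by linarith)]
    nlinarith [pow_pos hα 2]
  rw [Risk, if_neg h1.not_gt, mul_sub, mul_one, mul_one_div]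
  linarith

theorem tendsto_risk_atTop (α σ : ℝ) : Tendsto (Risk α σ) atTop (nhds (α ^ 2)) := by
  have h1 : Tendsto (fun γ : ℝ => 1 / γ) atTop (nhds 0) := tendsto_const_nhds.div_atTop tendsto_id
  have h2 : Tendsto (fun γ : ℝ => σ ^ 2 / (γ - 1)) atTop (nhds 0) :=
    tendsto_const_nhds.div_atTop (tendsto_atTop_add_const_right _ (-1) tendsto_id)
  have h3 := ((h1.const_sub 1).const_mul (α ^ 2)).add h2
  rw [sub_zero, mul_one, add_zero] at h3
  refine h3.congr' ?_
  filter_upwards [eventually_ge_atTop 1] with γ hγ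
  rw [Risk, if_neg hγ.not_gt]

/-- When `SNR = α/σ ≤ 1` and `φ > α²/(α²+σ²)`, every sketched estimator has risk exceeding
`α²`, and the risk tends to `α²` as `ψ → 0⁺`; hence the null estimator (sketching size
`m* = 0`) is optimal. -/
theorem null_estimator_optimal
    (α σ φ : ℝ) (hα : 0 < α) (hσ : α ≤ σ) (hφ : α ^ 2 / (α ^ 2 + σ ^ 2) < φ) :
    (∀ ψ : ℝ, 0 < ψ → ψ ≤ 1 → φ / ψ ≠ 1 → α ^ 2 < Risk α σ (φ / ψ)) ∧
    Tendsto (fun ψ : ℝ => Risk α σ (φ / ψ)) (nhdsWithin 0 (Set.Ioi 0)) (nhds (α ^ 2)) := by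
  have hφ0 : 0 < φ := lt_of_le_of_lt (by positivity) hφ
  refine ⟨fun ψ hψ hψ1 hne => ?_, ?_⟩
  · rcases lt_or_gt_of_ne hne with h | h
    · exact lt_risk_of_lt_one hα (hφ.trans_le (le_div_self hφ0.le hψ hψ1)) h
    · exact lt_risk_of_one_lt hα hσ h
  · refine (tendsto_risk_atTop α σ).comp ?_
    exact (tendsto_inv_nhdsGT_zero.const_mul_atTop hφ0).congr fun ψ => (div_eq_mul_inv φ ψ).symm
end

section
/- Let α, σ, φ > 0 and suppose either (i) 0 < α ≤ σ and φ ≤ α²/(α² + σ²), or (ii) α > σ > 0 and either φ ≤ 1 − σ/(2α) or φ > α/(α − σ). Then for every ψ ∈ (0, 1] with φ/ψ ≠ 1 one has R(φ/ψ) ≥ R(φ); moreover, in case (i) one also has R(φ) ≤ α². (Hence no sketching, ψ = 1, is optimal in these regimes.) -/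
theorem Risk_of_lt_one {α σ γ : ℝ} (h : γ < 1) : Risk α σ γ = σ ^ 2 * γ / (1 - γ) := if_pos h

theorem Risk_of_one_lt {α σ γ : ℝ} (h : 1 < γ) :
    Risk α σ γ = α ^ 2 * (1 - 1 / γ) + σ ^ 2 / (γ - 1) := if_neg h.not_gt

theorem Risk_le_of_lt_one (α σ : ℝ) {x y : ℝ} (hxy : x ≤ y) (hy : y < 1) :
    Risk α σ x ≤ Risk α σ y := by
  rw [Risk_of_lt_one (hxy.trans_lt hy), Risk_of_lt_one hy,
    div_le_div_iff₀ (by linarith) (by linarith)]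
  nlinarith [mul_nonneg (sq_nonneg σ) (sub_nonneg.2 hxy)]

theorem sq_le_Risk_of_one_lt {α σ γ : ℝ} (hα : 0 ≤ α) (h : α ≤ σ) (hγ : 1 < γ) :
    α ^ 2 ≤ Risk α σ γ := by
  have hγ0 : 0 < γ := by linarith
  have hγ1 : 0 < γ - 1 := by linarith
  have key : Risk α σ γ - α ^ 2 = ((σ ^ 2 - α ^ 2) * γ + α ^ 2) / (γ * (γ - 1)) := by
    rw [Risk_of_one_lt hγ]
    field_simp
    ring
  have hsq : 0 ≤ σ ^ 2 - α ^ 2 := sub_nonneg.2 (pow_le_pow_left₀ hα h 2)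
  have : 0 ≤ Risk α σ γ - α ^ 2 := by rw [key]; positivity
  linarith

/-- The minimum of the overparametrized branch, attained at `γ = α / (α - σ)` when `σ < α`. -/
theorem two_mul_sub_sq_le_Risk_of_one_lt (α σ : ℝ) {γ : ℝ} (hγ : 1 < γ) :
    2 * α * σ - σ ^ 2 ≤ Risk α σ γ := by
  have hγ0 : 0 < γ := by linarith
  have hγ1 : 0 < γ - 1 := by linarith
  have key : Risk α σ γ - (2 * α * σ - σ ^ 2) = ((α - σ) * γ - α) ^ 2 / (γ * (γ - 1)) := by
    rw [Risk_of_one_lt hγ]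
    field_simp
    ring
  have : 0 ≤ Risk α σ γ - (2 * α * σ - σ ^ 2) := by rw [key]; positivity
  linarith

theorem Risk_le_of_div_sub_le {α σ x y : ℝ} (hσ : 0 < σ) (h : σ < α)
    (hx : α / (α - σ) ≤ x) (hxy : x ≤ y) : Risk α σ x ≤ Risk α σ y := by
  have hd : 0 < α - σ := sub_pos.2 h
  have hx' : α ≤ x * (α - σ) := (div_le_iff₀ hd).1 hx
  have hx1 : 1 < x := ((one_lt_div hd).2 (by linarith)).trans_le hx
  have hy1 : 1 < y := hx1.trans_le hxy
  have hx0 : 0 < x - 1 := by linarith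
  have hy0 : 0 < y - 1 := by linarith
  have hxp : 0 < x := by linarith
  have hyp : 0 < y := by linarith
  have key : Risk α σ y - Risk α σ x =
      (y - x) * (α * (x - 1) * (α * (y - 1)) - σ * x * (σ * y)) /
        (x * y * ((x - 1) * (y - 1))) := by
    rw [Risk_of_one_lt hx1, Risk_of_one_lt hy1]
    field_simp
    ring
  have hprod : σ * x * (σ * y) ≤ α * (x - 1) * (α * (y - 1)) :=
    mul_le_mul (by linarith) (by nlinarith) (by positivity)
      (mul_nonneg (by linarith) hx0.le)
  have : 0 ≤ Risk α σ y - Risk α σ x := by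
    rw [key]
    exact div_nonneg (mul_nonneg (sub_nonneg.2 hxy) (sub_nonneg.2 hprod)) (by positivity)
  linarith

theorem lt_one_of_le_sq_div {α σ φ : ℝ} (hσ : 0 < σ)
    (h : φ ≤ α ^ 2 / (α ^ 2 + σ ^ 2)) : φ < 1 :=
  h.trans_lt ((div_lt_one (by positivity)).2 (by nlinarith [pow_pos hσ 2]))

theorem Risk_le_sq {α σ φ : ℝ} (hσ : 0 < σ)
    (h : φ ≤ α ^ 2 / (α ^ 2 + σ ^ 2)) : Risk α σ φ ≤ α ^ 2 := by
  have h1 := lt_one_of_le_sq_div hσ h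
  rw [le_div_iff₀ (by positivity)] at h
  rw [Risk_of_lt_one h1, div_le_iff₀ (by linarith)]
  linarith

theorem lt_one_of_le_one_sub_div {α σ φ : ℝ} (hα : 0 < α) (hσ : 0 < σ)
    (h : φ ≤ 1 - σ / (2 * α)) : φ < 1 := by
  have : 0 < σ / (2 * α) := by positivity
  linarith

theorem Risk_le_two_mul_sub_sq {α σ φ : ℝ} (hα : 0 < α) (hσ : 0 < σ)
    (h : φ ≤ 1 - σ / (2 * α)) : Risk α σ φ ≤ 2 * α * σ - σ ^ 2 := by
  have h1 := lt_one_of_le_one_sub_div hα hσ h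
  have h2 : σ ≤ (1 - φ) * (2 * α) := (div_le_iff₀ (by positivity)).1 (by linarith)
  rw [Risk_of_lt_one h1, div_le_iff₀ (by linarith)]
  nlinarith [mul_le_mul_of_nonneg_left h2 hσ.le]

/-- In the regimes (i) `α ≤ σ` and `φ ≤ α²/(α²+σ²)`, or (ii) `α > σ` and either
`φ ≤ 1 - σ/(2α)` or `φ > α/(α-σ)`, no sketching (`ψ = 1`) is optimal; moreover in case (i)
the full-sample risk is at most `α²`. -/
theorem no_sketching_optimal
    (α σ φ : ℝ) (hα : 0 < α) (hσ : 0 < σ) (hφ : 0 < φ)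
    (hcase : (α ≤ σ ∧ φ ≤ α ^ 2 / (α ^ 2 + σ ^ 2)) ∨
      (σ < α ∧ (φ ≤ 1 - σ / (2 * α) ∨ α / (α - σ) < φ))) :
    (∀ ψ : ℝ, 0 < ψ → ψ ≤ 1 → φ / ψ ≠ 1 → Risk α σ φ ≤ Risk α σ (φ / ψ)) ∧
    ((α ≤ σ ∧ φ ≤ α ^ 2 / (α ^ 2 + σ ^ 2)) → Risk α σ φ ≤ α ^ 2) := by
  refine ⟨fun ψ hψ hψ1 hne => ?_, fun h => Risk_le_sq hσ h.2⟩
  have hle : φ ≤ φ / ψ := le_div_self hφ.le hψ hψ1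
  rcases hne.lt_or_gt with hlt | hgt
  · exact Risk_le_of_lt_one α σ hle hlt
  · rcases hcase with ⟨h, h'⟩ | ⟨h, h' | h'⟩
    · exact (Risk_le_sq hσ h').trans (sq_le_Risk_of_one_lt hα.le h hgt)
    · exact (Risk_le_two_mul_sub_sq hα hσ h').trans (two_mul_sub_sq_le_Risk_of_one_lt α σ hgt)
    · exact Risk_le_of_div_sub_le hσ h h'.le hle
end

section
/- Let α > σ > 0. Then for every φ with 1 < φ ≤ α/(α − σ), one has 2α³(α − σ) ≤ 2σ⁴φ³/(φ − 1)⁴, with equality exactly when φ = α/(α − σ). (For standard Gaussian features in the overparameterized regime, the asymptotic variance of the risk of the optimally sketched estimator, 2α³(α−σ), is no larger than that of the full-sample estimator, 2σ⁴φ³/(φ−1)⁴.) -/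
/-- The function `x ↦ x³/(x-1)⁴` is strictly decreasing on `(1, ∞)`. -/
theorem strictAntiOn_cube_div_sub_one_pow_four :
    StrictAntiOn (fun x : ℝ => x ^ 3 / (x - 1) ^ 4) (Set.Ioi 1) := by
  intro x hx y _ hxy
  have hx1 : 0 < x - 1 := sub_pos.2 hx
  have hy1 : 0 < y - 1 := by linarith
  have hcube : (y * (x - 1)) ^ 3 < (x * (y - 1)) ^ 3 :=
    pow_lt_pow_left₀ (by linarith) (mul_nonneg (by linarith) hx1.le) three_ne_zero
  have hmul : (y * (x - 1)) ^ 3 * (x - 1) < (x * (y - 1)) ^ 3 * (y - 1) :=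
    mul_lt_mul'' hcube (by linarith) (pow_nonneg (mul_nonneg (by linarith) hx1.le) 3) hx1.le
  change y ^ 3 / (y - 1) ^ 4 < x ^ 3 / (x - 1) ^ 4
  rw [div_lt_div_iff₀ (pow_pos hy1 4) (pow_pos hx1 4)]
  linarith

/-- For Gaussian features in the overparameterized regime with `SNR > 1`, the asymptotic
variance `2α³(α-σ)` of the risk of the optimally sketched estimator is no larger than the
asymptotic variance `2σ⁴φ³/(φ-1)⁴` of the full-sample estimator, with equality exactly at
`φ = α/(α-σ)`. -/
theorem optimal_sketching_variance_over
    (α σ : ℝ) (hσ : 0 < σ) (hα : σ < α) :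
    ∀ φ : ℝ, 1 < φ → φ ≤ α / (α - σ) →
      2 * α ^ 3 * (α - σ) ≤ 2 * σ ^ 4 * φ ^ 3 / (φ - 1) ^ 4 ∧
      (2 * α ^ 3 * (α - σ) = 2 * σ ^ 4 * φ ^ 3 / (φ - 1) ^ 4 ↔ φ = α / (α - σ)) := by
  intro φ hφ hle
  have hd : 0 < α - σ := sub_pos.2 hα
  have hone : 1 < α / (α - σ) := hφ.trans_le hle
  have hvalue : 2 * α ^ 3 * (α - σ) =
      2 * σ ^ 4 * ((α / (α - σ)) ^ 3 / (α / (α - σ) - 1) ^ 4) := by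
    have hsub : α / (α - σ) - 1 = σ / (α - σ) := by
      field_simp
      ring
    rw [hsub]
    field_simp
  have hpos : 0 < 2 * σ ^ 4 := by positivity
  have hanti := strictAntiOn_cube_div_sub_one_pow_four
  rw [hvalue, mul_div_assoc]
  refine ⟨mul_le_mul_of_nonneg_left (hanti.antitoneOn hφ hone hle) hpos.le, fun h => ?_, ?_⟩
  · exact (hanti.injOn hone hφ (mul_left_cancel₀ hpos.ne' h)).symm
  · rintro rfl
    rfl
end

section
/- Let α > σ > 0. Then for every φ with 1 − σ/(2α) < φ < 1, one has 2α³(α − σ) ≤ σ⁴(2φ − 1)/(8(1 − φ)⁴) and σ⁴(2φ − 1)/(8(1 − φ)⁴) < 2σ⁴φ³/(1 − φ)⁴. (For standard Gaussian features in the underparameterized regime with SNR > 1, the asymptotic variance of the risk of the optimally sketched estimator is strictly smaller than that of the full-sample estimator.) -/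
/-- For Gaussian features in the underparameterized regime with `SNR > 1` and
`1 - σ/(2α) < φ < 1`, the asymptotic variance `2α³(α-σ)` of the risk of the optimally
sketched estimator is at most `σ⁴(2φ-1)/(8(1-φ)⁴)`, which is strictly smaller than the
asymptotic variance `2σ⁴φ³/(1-φ)⁴` of the full-sample estimator. -/
theorem optimal_sketching_variance_under
    (α σ : ℝ) (hσ : 0 < σ) (hα : σ < α) :
    ∀ φ : ℝ, 1 - σ / (2 * α) < φ → φ < 1 →
      2 * α ^ 3 * (α - σ) ≤ σ ^ 4 * (2 * φ - 1) / (8 * (1 - φ) ^ 4) ∧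
      σ ^ 4 * (2 * φ - 1) / (8 * (1 - φ) ^ 4) < 2 * σ ^ 4 * φ ^ 3 / (1 - φ) ^ 4 := by
  intro φ hφ hφ1
  have hα0 : 0 < α := hσ.trans hα
  have ht : 0 < 1 - φ := sub_pos.mpr hφ1
  have hx : 2 * α * (1 - φ) < σ := by
    have h : 1 - φ < σ / (2 * α) := by linarith
    rw [lt_div_iff₀ (by positivity)] at h
    linarith
  have hhalf : 0 < 2 * φ - 1 := by nlinarith
  constructor
  · rw [le_div_iff₀ (by positivity)]
    have hx0 : 0 ≤ 2 * α * (1 - φ) := by positivity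
    have hcube : (2 * α * (1 - φ)) ^ 3 ≤ σ ^ 3 := pow_le_pow_left₀ hx0 hx.le 3
    have h₁ : 0 ≤ (2 * α * (1 - φ)) ^ 3 * (σ - 2 * α * (1 - φ)) :=
      mul_nonneg (pow_nonneg hx0 3) (sub_nonneg.mpr hx.le)
    have h₂ : 0 ≤ (2 * φ - 1) * σ * (σ ^ 3 - (2 * α * (1 - φ)) ^ 3) :=
      mul_nonneg (by positivity) (sub_nonneg.mpr hcube)
    linarith
  · have hφ3 : 2 * φ - 1 < 16 * φ ^ 3 := by
      nlinarith [mul_pos hhalf (pow_pos (show 0 < φ by linarith) 2), sq_nonneg (φ - 1)]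
    rw [div_lt_div_iff₀ (by positivity) (by positivity)]
    have h : 0 < σ ^ 4 * (1 - φ) ^ 4 * (16 * φ ^ 3 - (2 * φ - 1)) :=
      mul_pos (by positivity) (sub_pos.mpr hφ3)
    linarith
end

section
/- Let φ, ψ > 0 with φψ⁻¹ > 1, let H be a Borel probability measure on ℝ whose support is contained in an interval [C₀, C₁] with 0 < C₀ ≤ C₁, and let c₀ < 0 be the unique negative solution of 1 = ∫ x/(−c₀ + x·ψφ⁻¹) dH(x). Then 0 < ∫ x²ψφ⁻¹/(c₀ − x·ψφ⁻¹)² dH(x) < 1, so that the limiting variance formula σ²·I/(1 − I), with I this integral, is well defined and positive. -/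
open MeasureTheory

/-- An integrable function that is almost everywhere positive has positive integral. -/
theorem integral_pos_of_ae_pos {α : Type*} [MeasurableSpace α] {μ : Measure α} [NeZero μ]
    {f : α → ℝ} (hf : Integrable f μ) (hpos : ∀ᵐ x ∂μ, 0 < f x) : 0 < ∫ x, f x ∂μ := by
  have hnonneg : 0 ≤ᵐ[μ] f := hpos.mono fun _ hx => hx.le
  refine (integral_nonneg_of_ae hnonneg).lt_of_ne fun h => ?_
  have hzero := (integral_eq_zero_iff_of_nonneg_ae hnonneg hf).1 h.symm
  obtain ⟨x, hx, hx'⟩ := (hpos.and hzero).exists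
  exact hx.ne' hx'

/-- In the overparameterized regime, with `c₀` the unique negative solution of the
self-consistent equation, the integral `I = ∫ x²ψφ⁻¹/(c₀ - xψφ⁻¹)² dH(x)` lies strictly
between 0 and 1, so the limiting variance `σ² I/(1-I)` is well defined and positive. -/
theorem over_variance_integral_bounds
    (φ ψ C₀ C₁ : ℝ) (hφ : 0 < φ) (hψ : 0 < ψ) (hratio : 1 < φ * ψ⁻¹)
    (hC₀ : 0 < C₀) (hC : C₀ ≤ C₁)
    (H : Measure ℝ) [IsProbabilityMeasure H]
    (hsupp : H (Set.Icc C₀ C₁)ᶜ = 0)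
    (c₀ : ℝ) (hc₀neg : c₀ < 0)
    (hc₀ : 1 = ∫ x, x / (-c₀ + x * (ψ * φ⁻¹)) ∂H) :
    0 < ∫ x, x ^ 2 * (ψ * φ⁻¹) / (c₀ - x * (ψ * φ⁻¹)) ^ 2 ∂H ∧
      (∫ x, x ^ 2 * (ψ * φ⁻¹) / (c₀ - x * (ψ * φ⁻¹)) ^ 2 ∂H) < 1 := by
  have ha : 0 < ψ * φ⁻¹ := mul_pos hψ (inv_pos.2 hφ)
  generalize ψ * φ⁻¹ = a at *
  have hx_pos : ∀ᵐ x ∂H, 0 < x := by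
    have hmem : ∀ᵐ x ∂H, x ∈ Set.Icc C₀ C₁ := hsupp
    exact hmem.mono fun x hx => hC₀.trans_le hx.1
  have hf : Integrable (fun x => x / (-c₀ + x * a)) H :=
    not_imp_comm.1 integral_undef (by rw [← hc₀]; exact one_ne_zero)
  have hg_pos : ∀ᵐ x ∂H, 0 < x ^ 2 * a / (c₀ - x * a) ^ 2 := by
    filter_upwards [hx_pos] with x hx
    have hne : c₀ - x * a ≠ 0 := by nlinarith [mul_pos hx ha]
    positivity
  have hlt : ∀ᵐ x ∂H, x ^ 2 * a / (c₀ - x * a) ^ 2 < x / (-c₀ + x * a) := by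
    filter_upwards [hx_pos] with x hx
    have hden : 0 < -c₀ + x * a := by linarith [mul_pos hx ha]
    rw [show (c₀ - x * a) ^ 2 = (-c₀ + x * a) ^ 2 by ring, div_lt_div_iff₀ (by positivity) hden]
    have hprod : 0 < x * (-c₀ + x * a) * -c₀ := mul_pos (mul_pos hx hden) (neg_pos.2 hc₀neg)
    linarith
  have hg : Integrable (fun x => x ^ 2 * a / (c₀ - x * a) ^ 2) H := by
    refine hf.mono' (Measurable.aestronglyMeasurable (by fun_prop)) ?_
    filter_upwards [hg_pos, hlt] with x hx hx'
    rw [Real.norm_of_nonneg hx.le]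
    exact hx'.le
  refine ⟨integral_pos_of_ae_pos hg hg_pos, ?_⟩
  have hdiff := integral_pos_of_ae_pos (hf.sub hg) (hlt.mono fun x hx => sub_pos.2 hx)
  rw [integral_sub' hf hg, ← hc₀] at hdiff
  exact sub_pos.1 hdiff
end
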